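/- Let (C, μ) be a flat-foldable MV pattern, let α be a crimpable sequence of C, and let (c_j, c_{j+1}) be an adjacent pair of creases within α with μ(c_j) ≠ μ(c_{j+1}). Let μ' be the MV assignment that is identical to μ except that μ'(c_j) = μ(c_{j+1}) and μ'(c_{j+1}) = μ(c_j). Then (C, μ') is flat-foldable. -/

import Mathlib

/-- Mountain or valley label for a crease. -/
inductive MV : Type
  | M : MV
  | V : MV
deriving DecidableEq

/-- `(c 0, c 1, …, c n)` is a 1D crease pattern: a strictly increasing finite
sequence of reals with `n ≥ 1`.  The points `c 1, …, c (n-1)` are its creases,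
`c 0` and `c n` its ends. -/
def IsCreasePattern (n : ℕ) (c : ℕ → ℝ) : Prop :=
  1 ≤ n ∧ ∀ i j : ℕ, i < j → j ≤ n → c i < c j

/-- The consecutive creases `(c i, …, c (i+k))` form a crimpable sequence with gap `d`. -/
def IsCrimpable (n : ℕ) (c : ℕ → ℝ) (i k : ℕ) (d : ℝ) : Prop :=
  1 ≤ i ∧ 1 ≤ k ∧ i + k ≤ n - 1 ∧
  (∀ m : ℕ, i ≤ m → m < i + k → c (m + 1) - c m = d) ∧
  d < c i - c (i - 1) ∧ d < c (i + k + 1) - c (i + k)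

/-- Additive offset of the folded-position map on the `j`-th interval:
on `[c j, c (j+1)]` the folded-position map is `x ↦ (-1)^j * x + foldOffset c j`. -/
def foldOffset (c : ℕ → ℝ) : ℕ → ℝ
  | 0 => 0
  | j + 1 => foldOffset c (j) + 2 * (-1 : ℝ) ^ j * c (j + 1)

/-- Folded position of a point `x` belonging to the `j`-th interval `[c j, c (j+1)]`.
This is the unique continuous map equal to the identity on `[c 0, c 1]`, isometric on
every interval, and reversing direction at every crease. -/
def foldPos (c : ℕ → ℝ) (j : ℕ) (x : ℝ) : ℝ := (-1 : ℝ) ^ j * x + foldOffset c j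

/-- Folded position of the crease `c i`. -/
def foldCrease (c : ℕ → ℝ) (i : ℕ) : ℝ := foldPos c i (c i)

/-- `x` lies strictly `lt`-between `a` and `b`. -/
def Between (lt : ℕ → ℕ → Prop) (a b x : ℕ) : Prop :=
  (lt a x ∧ lt x b) ∨ (lt b x ∧ lt x a)

/-- The MV pattern `(C, μ)` is flat-foldable: there is a strict linear order `lt`
("strictly below") on the intervals `I_0, …, I_{n-1}` (indexed `0, …, n-1`) such that:
(i) for each crease `i`, `I_{i-1}` is below `I_i` iff either `μ i = V` and the folded map
is increasing on `I_{i-1}` (slope `(-1)^(i-1) = 1`), or `μ i = M` and it is decreasing;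
(ii) for each crease `i` and each interval `J` whose folded image contains the folded
crease position in its interior, `J` is not strictly between `I_{i-1}` and `I_i`;
(iii) for distinct creases `i, j` folding to the same point, it is not the case that
exactly one of `I_{j-1}`, `I_j` is strictly between `I_{i-1}` and `I_i`. -/
def IsFlatFoldable (n : ℕ) (c : ℕ → ℝ) (μ : ℕ → MV) : Prop :=
  ∃ lt : ℕ → ℕ → Prop,
    (∀ j, j < n → ¬ lt j j) ∧
    (∀ a b e, lt a b → lt b e → lt a e) ∧
    (∀ a b, a < n → b < n → a ≠ b → lt a b ∨ lt b a) ∧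
    (∀ a b, lt a b → a < n ∧ b < n) ∧
    (∀ i, 1 ≤ i → i ≤ n - 1 →
      (lt (i - 1) i ↔ ((μ i = MV.V ∧ Even (i - 1)) ∨ (μ i = MV.M ∧ Odd (i - 1))))) ∧
    (∀ i, 1 ≤ i → i ≤ n - 1 → ∀ j, j < n →
      foldCrease c i ∈
        Set.Ioo (min (foldPos c j (c j)) (foldPos c j (c (j + 1))))
                (max (foldPos c j (c j)) (foldPos c j (c (j + 1)))) →
      ¬ Between lt (i - 1) i j) ∧
    (∀ i j, 1 ≤ i → i ≤ n - 1 → 1 ≤ j → j ≤ n - 1 → i ≠ j →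
      foldCrease c i = foldCrease c j →
      (Between lt (i - 1) i (j - 1) ↔ Between lt (i - 1) i j))

/-- `F` is a forcing set for the MV pattern `(C, μ)`: a set of creases such that the only
flat-foldable assignment agreeing with `μ` on `F` is `μ` itself (on all creases). -/
def IsForcingSet (n : ℕ) (c : ℕ → ℝ) (μ : ℕ → MV) (F : Set ℕ) : Prop :=
  F ⊆ Set.Icc 1 (n - 1) ∧
  ∀ ν : ℕ → MV, IsFlatFoldable n c ν → (∀ x ∈ F, ν x = μ x) →
    ∀ x, 1 ≤ x → x ≤ n - 1 → ν x = μ x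

/-- The crease pattern produced by a monocrimp at the adjacent pair `(c j, c (j+1))`:
it deletes `c j` and `c (j+1)` and translates all later points by `-2 * (c (j+1) - c j)`. -/
def monocrimpPattern (c : ℕ → ℝ) (j : ℕ) : ℕ → ℝ :=
  fun x => if x < j then c x else c (x + 2) - 2 * (c (j + 1) - c j)

/-- The stacking conditions for `n` layers with extents `[lo J, hi J]`, stacked by height `r`:
consecutive layers `i` and `i + 1` are joined at the point `x i`, and neither layers nor other
joints cross a joint. -/
structure IsStacking (n : ℕ) (lo hi x : ℕ → ℝ) (r : ℕ → ℕ) : Prop where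
  inj : ∀ u v, u < n → v < n → r u = r v → u = v
  layer : ∀ i, i + 1 < n → ∀ J, J < n → lo J < x i → x i < hi J →
    ¬ Between (fun u v => r u < r v) i (i + 1) J
  joint : ∀ i k, i + 1 < n → k + 1 < n → i ≠ k → x i = x k →
    (Between (fun u v => r u < r v) i (i + 1) k ↔
      Between (fun u v => r u < r v) i (i + 1) (k + 1))

open Classical in
/-- The block to which layer `J` is moved when the zigzag formed by the layers
`a`, `a + 1`, `a + 2` is collapsed and turned over.  Layers caught between `a` and `a + 1` or
between `a + 1` and `a + 2` go below the zigzag if they lie to the right of the joint bounding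
their pocket, and above it otherwise. -/
noncomputable def zigzagBlock (x lo : ℕ → ℝ) (r : ℕ → ℕ) (a J : ℕ) : ℕ :=
  if J = a then 5 else if J = a + 1 then 4 else if J = a + 2 then 3
  else if r J < r a then 0
  else if r (a + 2) < r J then 8
  else if r J < r (a + 1) then (if x a ≤ lo J then 1 else 6)
  else (if x (a + 1) ≤ lo J then 2 else 7)

theorem zigzagBlock_spec {n a : ℕ} {lo hi x : ℕ → ℝ} {r : ℕ → ℕ}
    (hr : IsStacking n lo hi x r) (ha : a + 2 < n)
    (h2 : r (a + 1) < r (a + 2)) {J : ℕ} (hJ : J < n) :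
    (zigzagBlock x lo r a J = 0 ∧ r J < r a) ∨
    (zigzagBlock x lo r a J = 1 ∧ r a < r J ∧ r J < r (a + 1) ∧ x a ≤ lo J) ∨
    (zigzagBlock x lo r a J = 2 ∧ r (a + 1) < r J ∧ r J < r (a + 2) ∧ x (a + 1) ≤ lo J) ∨
    (zigzagBlock x lo r a J = 3 ∧ J = a + 2) ∨
    (zigzagBlock x lo r a J = 4 ∧ J = a + 1) ∨
    (zigzagBlock x lo r a J = 5 ∧ J = a) ∨
    (zigzagBlock x lo r a J = 6 ∧ r a < r J ∧ r J < r (a + 1) ∧ hi J ≤ x a) ∨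
    (zigzagBlock x lo r a J = 7 ∧ r (a + 1) < r J ∧ r J < r (a + 2) ∧ hi J ≤ x (a + 1)) ∨
    (zigzagBlock x lo r a J = 8 ∧ r (a + 2) < r J) := by
  have e0 := hr.inj J a hJ (by omega)
  have e1 := hr.inj J (a + 1) hJ (by omega)
  have e2 := hr.inj J (a + 2) hJ (by omega)
  have l0 := hr.layer a (by omega) J hJ
  have l1 := hr.layer (a + 1) (by omega) J hJ
  simp only [Between, show a + 1 + 1 = a + 2 from rfl] at l0 l1
  unfold zigzagBlock
  split_ifs with g0 g1 g2 g3 g4 g5 g6 g7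
  · simp [g0]
  · simp [g1]
  · simp [g2]
  · simp [g3]
  · simp [g4]
  · have : r a < r J := by omega
    simp [*]
  · have : r a < r J := by omega
    have : hi J ≤ x a := by
      by_contra! h
      exact l0 (not_le.mp g6) h (by omega)
    simp [*]
  · have : r (a + 1) < r J := by omega
    have : r J < r (a + 2) := by omega
    simp [*]
  · have : r (a + 1) < r J := by omega
    have : r J < r (a + 2) := by omega
    have : hi J ≤ x (a + 1) := by
      by_contra! h
      exact l1 (not_le.mp g7) h (by omega)
    simp [*]

/-- The blocks of the two layers meeting at a joint other than those of the zigzag. -/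
theorem zigzagBlock_joint {n a : ℕ} {lo hi x : ℕ → ℝ} {r : ℕ → ℕ}
    (hr : IsStacking n lo hi x r) (ha : a + 2 < n)
    (hlh : ∀ J, J < n → lo J < hi J)
    (hside : ∀ i, i + 1 < n → (Even (i + a) ∧ hi i = x i ∧ hi (i + 1) = x i) ∨
      (¬ Even (i + a) ∧ lo i = x i ∧ lo (i + 1) = x i))
    (hA : lo a ≤ x (a + 1)) (hE : x a ≤ hi (a + 2))
    (h1 : r a < r (a + 1)) (h2 : r (a + 1) < r (a + 2))
    {i : ℕ} (hi1 : i + 1 < n) (hia : i ≠ a) (hia1 : i ≠ a + 1)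
    {b b' : ℕ} (hb : b = zigzagBlock x lo r a i) (hb' : b' = zigzagBlock x lo r a (i + 1)) :
    (x i < x (a + 1) ∧ (b = 0 ∨ 5 ≤ b ∧ b ≤ 8) ∧ (b' = 0 ∨ 5 ≤ b' ∧ b' ≤ 8)) ∨
    (x a < x i ∧ (b ≤ 3 ∨ b = 8) ∧ (b' ≤ 3 ∨ b' = 8)) ∨
    (x (a + 1) < x i ∧ x i < x a ∧ b = b' ∧ (b = 0 ∨ b = 2 ∨ b = 6 ∨ b = 8)) ∨
    (x i = x a ∧ (b = b' ∧ (b = 1 ∨ b = 6) ∨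
      (b = 0 ∨ b = 2 ∨ b = 3 ∨ b = 8) ∧ (b' = 0 ∨ b' = 2 ∨ b' = 3 ∨ b' = 8))) ∨
    (x i = x (a + 1) ∧ (b = b' ∧ (b = 2 ∨ b = 7) ∨
      (b = 0 ∨ b = 5 ∨ b = 6 ∨ b = 8) ∧ (b' = 0 ∨ b' = 5 ∨ b' = 6 ∨ b' = 8))) := by
  subst hb hb'
  have hAhi : hi a = x a ∧ hi (a + 1) = x a := by
    rcases hside a (by omega) with h | h
    · exact h.2
    · exact absurd ⟨a, rfl⟩ h.1
  have hElo : lo (a + 1) = x (a + 1) ∧ lo (a + 2) = x (a + 1) := by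
    rcases hside (a + 1) (by omega) with h | h
    · exact absurd h.1 (by grind)
    · exact h.2
  have hB := hlh (a + 1) (by omega)
  have touch : ∀ J, J < n → J ≠ a + 1 → (J = a → lo J = x i) → (J = a + 2 → hi J = x i) →
      lo J ≤ x i → x i ≤ hi J →
      (x i < x (a + 1) → zigzagBlock x lo r a J = 0 ∨
        5 ≤ zigzagBlock x lo r a J ∧ zigzagBlock x lo r a J ≤ 8) ∧
      (x a < x i → zigzagBlock x lo r a J ≤ 3 ∨ zigzagBlock x lo r a J = 8) ∧
      (x (a + 1) < x i → x i < x a →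
        (zigzagBlock x lo r a J = 0 ∧ r J < r a) ∨
        (zigzagBlock x lo r a J = 2 ∧ r (a + 1) < r J ∧ r J < r (a + 2)) ∨
        (zigzagBlock x lo r a J = 6 ∧ r a < r J ∧ r J < r (a + 1)) ∨
        (zigzagBlock x lo r a J = 8 ∧ r (a + 2) < r J)) ∧
      (x i = x a →
        (zigzagBlock x lo r a J = 1 ∧ r a < r J ∧ r J < r (a + 1) ∧ x a ≤ lo J) ∨
        (zigzagBlock x lo r a J = 6 ∧ r a < r J ∧ r J < r (a + 1) ∧ hi J ≤ x a) ∨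
        ((zigzagBlock x lo r a J = 0 ∨ zigzagBlock x lo r a J = 2 ∨
          zigzagBlock x lo r a J = 3 ∨ zigzagBlock x lo r a J = 8) ∧
          ¬ (r a < r J ∧ r J < r (a + 1)))) ∧
      (x i = x (a + 1) →
        (zigzagBlock x lo r a J = 2 ∧ r (a + 1) < r J ∧ r J < r (a + 2) ∧ x (a + 1) ≤ lo J) ∨
        (zigzagBlock x lo r a J = 7 ∧ r (a + 1) < r J ∧ r J < r (a + 2) ∧ hi J ≤ x (a + 1)) ∨
        ((zigzagBlock x lo r a J = 0 ∨ zigzagBlock x lo r a J = 5 ∨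
          zigzagBlock x lo r a J = 6 ∨ zigzagBlock x lo r a J = 8) ∧
          ¬ (r (a + 1) < r J ∧ r J < r (a + 2)))) := by
    intro J hJ n1 n0 n2 hl hu
    have hJ' := hlh J hJ
    rcases zigzagBlock_spec hr ha h2 hJ with
      h | h | h | h | h | h | h | h | h
    all_goals
      rw [h.1]
      refine ⟨fun hz => ?_, fun hz => ?_, fun hz hz' => ?_, fun hz => ?_, fun hz => ?_⟩
    all_goals grind
  have bi := hlh i (by omega)
  have bi' := hlh (i + 1) (by omega)
  have ti := touch i (by omega) hia1
  have ti' := touch (i + 1) hi1 (by omega)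
  have la := hr.layer i hi1 a (by omega)
  have lb := hr.layer i hi1 (a + 1) (by omega)
  have le := hr.layer i hi1 (a + 2) (by omega)
  have ja := hr.joint a i (by omega) hi1 (by omega)
  have je := hr.joint (a + 1) i (by omega) hi1 (by omega)
  simp only [Between, show a + 1 + 1 = a + 2 from rfl] at la lb le ja je
  have key : (lo i ≤ x i ∧ x i ≤ hi i ∧ (i = a + 2 → hi i = x i)) ∧
      (lo (i + 1) ≤ x i ∧ x i ≤ hi (i + 1) ∧ (i + 1 = a → lo (i + 1) = x i)) := by
    rcases hside i hi1 with ⟨hp, e, e'⟩ | ⟨hp, e, e'⟩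
    · refine ⟨⟨by linarith, e.ge, fun _ => e⟩, by linarith, e'.ge, ?_⟩
      rintro rfl
      exact absurd hp (by grind)
    · refine ⟨⟨e.le, by linarith, ?_⟩, e'.le, by linarith, fun _ => e'⟩
      rintro rfl
      exact absurd hp (by grind)
  obtain ⟨⟨k1, k2, k3⟩, k4, k5, k6⟩ := key
  have ti := ti (fun h => absurd h hia) k3 k1 k2
  have ti' := ti' k6 (by omega) k4 k5
  generalize zigzagBlock x lo r a i = b at *
  generalize zigzagBlock x lo r a (i + 1) = b' at *
  rcases lt_trichotomy (x i) (x (a + 1)) with hz | hz | hz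
  · exact Or.inl ⟨hz, ti.1 hz, ti'.1 hz⟩
  · refine Or.inr (Or.inr (Or.inr (Or.inr ⟨hz, ?_⟩)))
    have u := ti.2.2.2.2 hz
    have v := ti'.2.2.2.2 hz
    have w := je hz.symm
    have sd := hside i hi1
    clear touch hr hside ti ti' ja je la lb le hlh
    rcases sd with ⟨-, e, e'⟩ | ⟨-, e, e'⟩
    · grind
    · grind
  · rcases lt_trichotomy (x i) (x a) with hz' | hz' | hz'
    · refine Or.inr (Or.inr (Or.inl ⟨hz, hz', ?_⟩))
      have u := ti.2.2.1 hz hz'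
      have v := ti'.2.2.1 hz hz'
      have := la (by linarith) (by linarith)
      have := lb (by linarith) (by linarith)
      have := le (by linarith) (by linarith)
      omega
    · refine Or.inr (Or.inr (Or.inr (Or.inl ⟨hz', ?_⟩)))
      have u := ti.2.2.2.1 hz'
      have v := ti'.2.2.2.1 hz'
      have w := ja hz'.symm
      have sd := hside i hi1
      clear touch hr hside ti ti' ja je la lb le hlh
      rcases sd with ⟨-, e, e'⟩ | ⟨-, e, e'⟩
      · grind
      · grind
    · exact Or.inr (Or.inl ⟨hz', ti.2.1 hz', ti'.2.1 hz'⟩)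

/-- The block of a layer containing a given point in its interior. -/
theorem zigzagBlock_layer {n a : ℕ} {lo hi x : ℕ → ℝ} {r : ℕ → ℕ}
    (hr : IsStacking n lo hi x r) (ha : a + 2 < n)
    (hside : ∀ i, i + 1 < n → (Even (i + a) ∧ hi i = x i ∧ hi (i + 1) = x i) ∨
      (¬ Even (i + a) ∧ lo i = x i ∧ lo (i + 1) = x i))
    (hlt : x (a + 1) < x a)
    (h2 : r (a + 1) < r (a + 2))
    {J : ℕ} (hJ : J < n) {z : ℝ} (hz : lo J < z) (hz' : z < hi J)
    {b : ℕ} (hb : b = zigzagBlock x lo r a J) :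
    (z < x (a + 1) → b = 0 ∨ 5 ≤ b ∧ b ≤ 8) ∧
    (x a < z → b ≤ 3 ∨ b = 8) ∧
    (z = x a → b = 0 ∨ b = 2 ∨ b = 3 ∨ b = 8) ∧
    (z = x (a + 1) → b = 0 ∨ b = 5 ∨ b = 6 ∨ b = 8) := by
  subst hb
  have hAhi : hi a = x a ∧ hi (a + 1) = x a := by
    rcases hside a (by omega) with h | h
    · exact h.2
    · exact absurd ⟨a, rfl⟩ h.1
  have hElo : lo (a + 1) = x (a + 1) ∧ lo (a + 2) = x (a + 1) := by
    rcases hside (a + 1) (by omega) with h | h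
    · exact absurd h.1 (by grind)
    · exact h.2
  have spec := zigzagBlock_spec hr ha h2 hJ
  clear hr hside h2 ha hJ
  rcases spec with
    h | h | h | h | h | h | h | h | h
  all_goals
    rw [h.1]
    refine ⟨fun h' => ?_, fun h' => ?_, fun h' => ?_, fun h' => ?_⟩
  all_goals grind

theorem lex_lt_iff {n : ℕ} {b r : ℕ → ℕ} (hrn : ∀ J, r J < n) (u v : ℕ) :
    n * b u + r u < n * b v + r v ↔ b u < b v ∨ b u = b v ∧ r u < r v := by
  have := hrn u
  have := hrn v
  rcases lt_trichotomy (b u) (b v) with h | h | h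
  · have := Nat.mul_le_mul_left n (Nat.succ_le_of_lt h)
    rw [Nat.mul_succ] at this
    omega
  · rw [h]; omega
  · have := Nat.mul_le_mul_left n (Nat.succ_le_of_lt h)
    rw [Nat.mul_succ] at this
    omega

/-- Rearranging layers block by block preserves the order of two layers neither or both of which
were caught in the zigzag on a common side of it. -/
theorem lex_lt_iff_of_blocks {n a : ℕ} {b r : ℕ → ℕ} (hrn : ∀ J, r J < n)
    (h1 : r a < r (a + 1)) (h2 : r (a + 1) < r (a + 2))
    (spec : ∀ J, J < n → (b J = 0 ∧ r J < r a) ∨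
      ((b J = 1 ∨ b J = 6) ∧
        r a < r J ∧ r J < r (a + 1)) ∨
      ((b J = 2 ∨ b J = 7) ∧
        r (a + 1) < r J ∧ r J < r (a + 2)) ∨
      (b J = 3 ∧ r J = r (a + 2)) ∨
      (b J = 4 ∧ r J = r (a + 1)) ∨
      (b J = 5 ∧ r J = r a) ∨
      (b J = 8 ∧ r (a + 2) < r J))
    {u v : ℕ} (hu : u < n) (hv : v < n)
    (h : (b u = 0 ∨ 5 ≤ b u ∧ b u ≤ 8) ∧ (b v = 0 ∨ 5 ≤ b v ∧ b v ≤ 8) ∨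
      (b u ≤ 3 ∨ b u = 8) ∧ (b v ≤ 3 ∨ b v = 8) ∨ b u = b v) :
    n * b u + r u < n * b v + r v ↔ r u < r v := by
  rw [lex_lt_iff hrn]
  have s0 := spec u hu
  have s1 := spec v hv
  rcases h with h | h | h
  · rcases s0 with s0 | s0 | s0 | s0 | s0 | s0 | s0 <;> omega
  · rcases s0 with s0 | s0 | s0 | s0 | s0 | s0 | s0 <;> omega
  · omega

set_option maxHeartbeats 1000000 in
theorem IsStacking.exists_zigzag_reversed {n a : ℕ} {lo hi x : ℕ → ℝ} {r : ℕ → ℕ}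
    (hr : IsStacking n lo hi x r) (hrn : ∀ J, r J < n) (ha : a + 2 < n)
    (hlh : ∀ J, J < n → lo J < hi J)
    (hside : ∀ i, i + 1 < n → (Even (i + a) ∧ hi i = x i ∧ hi (i + 1) = x i) ∨
      (¬ Even (i + a) ∧ lo i = x i ∧ lo (i + 1) = x i))
    (hA : lo a ≤ x (a + 1)) (hE : x a ≤ hi (a + 2))
    (h1 : r a < r (a + 1)) (h2 : r (a + 1) < r (a + 2)) :
    ∃ s : ℕ → ℕ, IsStacking n lo hi x s ∧ (∀ J, s J < n * 9) ∧ s (a + 1) < s a ∧ s (a + 2) < s (a + 1) ∧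
      ∀ i, i + 1 < n → i ≠ a → i ≠ a + 1 → (s i < s (i + 1) ↔ r i < r (i + 1)) := by
  have hlt : x (a + 1) < x a := by
    have h := hlh (a + 1) (by omega)
    rcases hside a (by omega) with h' | h'
    · rcases hside (a + 1) (by omega) with h'' | h''
      · exact absurd h''.1 (by grind)
      · rwa [h'.2.2, h''.2.1] at h
    · exact absurd ⟨a, rfl⟩ h'.1
  have spec := fun J (hJ : J < n) => zigzagBlock_spec hr ha h2 hJ
  have jnt := fun i (hi1 : i + 1 < n) (e : i ≠ a) (e' : i ≠ a + 1) =>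
    zigzagBlock_joint hr ha hlh hside hA hE h1 h2 hi1 e e' rfl rfl
  have lyr := fun J (hJ : J < n) (z : ℝ) (e : lo J < z) (e' : z < hi J) =>
    zigzagBlock_layer hr ha hside hlt h2 hJ e e' rfl
  have spec' : ∀ J, J < n → (zigzagBlock x lo r a J = 0 ∧ r J < r a) ∨
      ((zigzagBlock x lo r a J = 1 ∨ zigzagBlock x lo r a J = 6) ∧
        r a < r J ∧ r J < r (a + 1)) ∨
      ((zigzagBlock x lo r a J = 2 ∨ zigzagBlock x lo r a J = 7) ∧
        r (a + 1) < r J ∧ r J < r (a + 2)) ∨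
      (zigzagBlock x lo r a J = 3 ∧ r J = r (a + 2)) ∨
      (zigzagBlock x lo r a J = 4 ∧ r J = r (a + 1)) ∨
      (zigzagBlock x lo r a J = 5 ∧ r J = r a) ∨
      (zigzagBlock x lo r a J = 8 ∧ r (a + 2) < r J) := by
    intro J hJ
    rcases spec J hJ with h | h | h | ⟨h, rfl⟩ | ⟨h, rfl⟩ | ⟨h, rfl⟩ | h | h | h <;> simp [h]
  have ba : zigzagBlock x lo r a a = 5 := by simp [zigzagBlock]
  have bb : zigzagBlock x lo r a (a + 1) = 4 := by simp [zigzagBlock]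
  have be : zigzagBlock x lo r a (a + 2) = 3 := by simp [zigzagBlock]
  have bmax : ∀ J, zigzagBlock x lo r a J ≤ 8 := by
    intro J
    unfold zigzagBlock
    split_ifs <;> omega
  clear spec
  generalize zigzagBlock x lo r a = b at *
  have lex := lex_lt_iff (b := b) hrn
  have agree := fun u v (hu : u < n) (hv : v < n) =>
    lex_lt_iff_of_blocks (u := u) (v := v) hrn h1 h2 spec' hu hv
  refine ⟨fun J => n * b J + r J, ⟨?_, ?_, ?_⟩, ?_, ?_, ?_, ?_⟩
  · intro u v hu hv h
    apply hr.inj u v hu hv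
    have := lex u v
    have := lex v u
    omega
  · intro i hi1 J hJ hz hz'
    have hl := hr.layer i hi1 J hJ hz hz'
    have hb := lyr J hJ _ hz hz'
    have h_agree : ∀ {U : ℕ → Prop},
        (∀ u v, u < n → v < n → U (b u) → U (b v) →
          (n * b u + r u < n * b v + r v ↔ r u < r v)) →
        U (b i) → U (b (i + 1)) → U (b J) →
        ¬ Between (fun u v => n * b u + r u < n * b v + r v) i (i + 1) J := by
      intro U hU u1 u2 u3
      have hi0 : i < n := by omega
      simp only [Between] at hl ⊢
      rwa [hU _ _ hi0 hJ u1 u3, hU _ _ hJ hi1 u3 u2, hU _ _ hi1 hJ u2 u3, hU _ _ hJ hi0 u3 u1]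
    have h_left := h_agree (U := fun m => m = 0 ∨ 5 ≤ m ∧ m ≤ 8)
      (fun u v hu hv e e' => agree u v hu hv (.inl ⟨e, e'⟩))
    have h_right := h_agree (U := fun m => m ≤ 3 ∨ m = 8)
      (fun u v hu hv e e' => agree u v hu hv (.inr (.inl ⟨e, e'⟩)))
    have h_same : b i = b (i + 1) →
        ¬ Between (fun u v => n * b u + r u < n * b v + r v) i (i + 1) J := by
      intro e
      simp only [Between, lex] at hl ⊢
      omega
    by_cases hia : i = a
    · subst hia
      have := hb.2.2.1 rfl
      simp only [Between, lex]
      omega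
    by_cases hia1 : i = a + 1
    · subst hia1
      have := hb.2.2.2 rfl
      have : b (a + 1 + 1) = 3 := be
      simp only [Between, lex]
      omega
    rcases jnt i hi1 hia hia1 with ⟨h, h'⟩ | ⟨h, h'⟩ | ⟨h, h', h''⟩ | ⟨h, h'⟩ | ⟨h, h'⟩
    · exact h_left h'.1 h'.2 (hb.1 h)
    · exact h_right h'.1 h'.2 (hb.2.1 h)
    · exact h_same h''.1
    · have := hb.2.2.1 h
      rcases h' with h' | h'
      · exact h_same h'.1
      · exact h_right (by omega) (by omega) (by omega)
    · have := hb.2.2.2 h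
      rcases h' with h' | h'
      · exact h_same h'.1
      · exact h_left (by omega) (by omega) (by omega)
  · intro i k hi1 hk1 hik hxx
    have hj := hr.joint i k hi1 hk1 hik hxx
    have h_agree : ∀ {U : ℕ → Prop},
        (∀ u v, u < n → v < n → U (b u) → U (b v) →
          (n * b u + r u < n * b v + r v ↔ r u < r v)) →
        U (b i) → U (b (i + 1)) → U (b k) → U (b (k + 1)) →
        (Between (fun u v => n * b u + r u < n * b v + r v) i (i + 1) k ↔
          Between (fun u v => n * b u + r u < n * b v + r v) i (i + 1) (k + 1)) := by
      intro U hU u1 u2 u3 u4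
      have hi0 : i < n := by omega
      have hk0 : k < n := by omega
      simp only [Between] at hj ⊢
      rwa [hU _ _ hi0 hk0 u1 u3, hU _ _ hk0 hi1 u3 u2, hU _ _ hi1 hk0 u2 u3,
        hU _ _ hk0 hi0 u3 u1, hU _ _ hi0 hk1 u1 u4, hU _ _ hk1 hi1 u4 u2,
        hU _ _ hi1 hk1 u2 u4, hU _ _ hk1 hi0 u4 u1]
    have h_left := h_agree (U := fun m => m = 0 ∨ 5 ≤ m ∧ m ≤ 8)
      (fun u v hu hv e e' => agree u v hu hv (.inl ⟨e, e'⟩))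
    have h_right := h_agree (U := fun m => m ≤ 3 ∨ m = 8)
      (fun u v hu hv e e' => agree u v hu hv (.inr (.inl ⟨e, e'⟩)))
    have h_same := h_agree (U := fun m => m = b i)
      (fun u v hu hv e e' => agree u v hu hv (.inr (.inr (e.trans e'.symm))))
    have be' : b (a + 1 + 1) = 3 := be
    clear hr spec' lyr agree h_agree hj
    have h_outer : (b k < b i ∧ b k < b (i + 1) ∨ b i < b k ∧ b (i + 1) < b k) →
        (b (k + 1) < b i ∧ b (k + 1) < b (i + 1) ∨ b i < b (k + 1) ∧ b (i + 1) < b (k + 1)) →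
        (Between (fun u v => n * b u + r u < n * b v + r v) i (i + 1) k ↔
          Between (fun u v => n * b u + r u < n * b v + r v) i (i + 1) (k + 1)) := by
      intro e e'
      simp only [Between, lex]
      omega
    have h_inner : (∀ m, (b k ≤ m ∧ m ≤ b (k + 1) ∨ b (k + 1) ≤ m ∧ m ≤ b k) →
        b i ≠ m ∧ b (i + 1) ≠ m) →
        (Between (fun u v => n * b u + r u < n * b v + r v) i (i + 1) k ↔
          Between (fun u v => n * b u + r u < n * b v + r v) i (i + 1) (k + 1)) := by
      intro e
      have e1 := e (b i)
      have e2 := e (b (i + 1))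
      simp only [Between, lex]
      omega
    by_cases hia : i = a
    · subst hia
      rcases eq_or_ne k (i + 1) with rfl | hka1
      · exact absurd hxx hlt.ne'
      rcases jnt k hk1 hik.symm hka1 with ⟨h, -⟩ | ⟨h, -⟩ | ⟨-, h, -⟩ | ⟨-, h⟩ | ⟨h, -⟩
      · exact absurd h (by linarith)
      · exact absurd h (by linarith)
      · exact absurd h (by linarith)
      · rcases h with h | h
        · exact h_inner (by omega)
        · exact h_outer (by omega) (by omega)
      · exact absurd h (by linarith)
    by_cases hia1 : i = a + 1
    · subst hia1
      rcases eq_or_ne k a with rfl | hka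
      · exact absurd hxx hlt.ne
      rcases jnt k hk1 hka hik.symm with ⟨h, -⟩ | ⟨h, -⟩ | ⟨h, -, -⟩ | ⟨h, -⟩ | ⟨-, h⟩
      · exact absurd h (by linarith)
      · exact absurd h (by linarith)
      · exact absurd h (by linarith)
      · exact absurd h (by linarith)
      · rcases h with h | h
        · exact h_inner (by omega)
        · exact h_outer (by omega) (by omega)
    have hi := jnt i hi1 hia hia1
    by_cases hka : k = a
    · subst hka
      rcases hi with ⟨h, -⟩ | ⟨h, -⟩ | ⟨-, h, -⟩ | ⟨-, h⟩ | ⟨h, -⟩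
      · exact absurd h (by linarith)
      · exact absurd h (by linarith)
      · exact absurd h (by linarith)
      · rcases h with h | h
        · exact h_outer (by omega) (by omega)
        · exact h_inner (by omega)
      · exact absurd h (by linarith)
    by_cases hka1 : k = a + 1
    · subst hka1
      rcases hi with ⟨h, -⟩ | ⟨h, -⟩ | ⟨h, -, -⟩ | ⟨h, -⟩ | ⟨-, h⟩
      · exact absurd h (by linarith)
      · exact absurd h (by linarith)
      · exact absurd h (by linarith)
      · exact absurd h (by linarith)
      · rcases h with h | h
        · exact h_outer (by omega) (by omega)
        · exact h_inner (by omega)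
    have hk := jnt k hk1 hka hka1
    clear jnt
    rw [← hxx] at hk
    rcases hi with ⟨z, h⟩ | ⟨z, h⟩ | ⟨z, z', h⟩ | ⟨z, h⟩ | ⟨z, h⟩ <;>
      rcases hk with ⟨w, h'⟩ | ⟨w, h'⟩ | ⟨w, w', h'⟩ | ⟨w, h'⟩ | ⟨w, h'⟩ <;>
      first
      | exact h_left h.1 h.2 h'.1 h'.2
      | exact h_right h.1 h.2 h'.1 h'.2
      | (exfalso; linarith)
      | skip
    · by_cases e : b k = b i
      · exact h_same rfl (by omega) e (by omega)
      · exact h_outer (by omega) (by omega)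
    · rcases h with h | h <;> rcases h' with h' | h'
      · by_cases e : b k = b i
        · exact h_same rfl (by omega) e (by omega)
        · exact h_outer (by omega) (by omega)
      · exact h_outer (by omega) (by omega)
      · exact h_inner (by omega)
      · exact h_right (by omega) (by omega) (by omega) (by omega)
    · rcases h with h | h <;> rcases h' with h' | h'
      · by_cases e : b k = b i
        · exact h_same rfl (by omega) e (by omega)
        · exact h_outer (by omega) (by omega)
      · exact h_outer (by omega) (by omega)
      · exact h_inner (by omega)
      · exact h_left (by omega) (by omega) (by omega) (by omega)
  · intro J
    have := hrn J
    have := Nat.mul_le_mul_left n (bmax J)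
    dsimp only
    omega
  · simp only [lex]; omega
  · simp only [lex]; omega
  · intro i hi1 hia hia1
    apply agree i (i + 1) (by omega) hi1
    rcases jnt i hi1 hia hia1 with h | h | h | h | h <;> omega

/-- Left end of the folded image of interval `J`, after reflecting the line if `ε = -1`. -/
noncomputable def foldLo (ε : ℝ) (c : ℕ → ℝ) (J : ℕ) : ℝ :=
  min (ε * foldPos c J (c J)) (ε * foldPos c J (c (J + 1)))

/-- Right end of the folded image of interval `J`, after reflecting the line if `ε = -1`. -/
noncomputable def foldHi (ε : ℝ) (c : ℕ → ℝ) (J : ℕ) : ℝ :=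
  max (ε * foldPos c J (c J)) (ε * foldPos c J (c (J + 1)))

theorem foldPos_right (c : ℕ → ℝ) (i : ℕ) : foldPos c i (c (i + 1)) = foldCrease c (i + 1) := by
  simp only [foldCrease, foldPos, foldOffset]
  ring

theorem foldLo_foldHi_of_even {n : ℕ} {c : ℕ → ℝ} (hC : IsCreasePattern n c) {a J : ℕ}
    (hJ : J < n) (h : Even (J + a)) :
    foldLo ((-1) ^ a) c J = (-1) ^ a * foldCrease c J ∧
      foldHi ((-1) ^ a) c J = (-1) ^ a * foldCrease c (J + 1) ∧
      (-1) ^ a * foldCrease c (J + 1) - (-1) ^ a * foldCrease c J = c (J + 1) - c J := by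
  have hc := hC.2 J (J + 1) (by omega) hJ
  have hs : (-1 : ℝ) ^ a * (-1) ^ J = 1 := by
    rw [← pow_add, add_comm a J]
    exact h.neg_one_pow
  have key : (-1 : ℝ) ^ a * foldCrease c (J + 1) - (-1) ^ a * foldCrease c J =
      c (J + 1) - c J := by
    rw [← foldPos_right, foldCrease, foldPos, foldPos]
    linear_combination (c (J + 1) - c J) * hs
  refine ⟨?_, ?_, key⟩
  · rw [foldLo, foldPos_right, ← foldCrease]
    exact min_eq_left (by linarith)
  · rw [foldHi, foldPos_right, ← foldCrease]
    exact max_eq_right (by linarith)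

theorem foldLo_foldHi_of_odd {n : ℕ} {c : ℕ → ℝ} (hC : IsCreasePattern n c) {a J : ℕ}
    (hJ : J < n) (h : ¬ Even (J + a)) :
    foldLo ((-1) ^ a) c J = (-1) ^ a * foldCrease c (J + 1) ∧
      foldHi ((-1) ^ a) c J = (-1) ^ a * foldCrease c J ∧
      (-1) ^ a * foldCrease c J - (-1) ^ a * foldCrease c (J + 1) = c (J + 1) - c J := by
  have hc := hC.2 J (J + 1) (by omega) hJ
  have hs : (-1 : ℝ) ^ a * (-1) ^ J = -1 := by
    rw [← pow_add, add_comm a J]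
    exact (Nat.not_even_iff_odd.mp h).neg_one_pow
  have key : (-1 : ℝ) ^ a * foldCrease c J - (-1) ^ a * foldCrease c (J + 1) =
      c (J + 1) - c J := by
    rw [← foldPos_right, foldCrease, foldPos, foldPos]
    linear_combination (c J - c (J + 1)) * hs
  refine ⟨?_, ?_, key⟩
  · rw [foldLo, foldPos_right, ← foldCrease]
    exact min_eq_right (by linarith)
  · rw [foldHi, foldPos_right, ← foldCrease]
    exact max_eq_left (by linarith)

theorem mem_Ioo_min_max_iff {ε : ℝ} (hε : ε = 1 ∨ ε = -1) (z u v : ℝ) :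
    z ∈ Set.Ioo (min u v) (max u v) ↔
      min (ε * u) (ε * v) < ε * z ∧ ε * z < max (ε * u) (ε * v) := by
  rcases hε with rfl | rfl
  · simp [Set.mem_Ioo]
  · simp only [Set.mem_Ioo, neg_one_mul, min_neg_neg, max_neg_neg, neg_lt_neg_iff]
    exact and_comm

theorem between_congr {lt lt' : ℕ → ℕ → Prop} {n : ℕ}
    (h : ∀ u v, u < n → v < n → (lt u v ↔ lt' u v)) {u v w : ℕ}
    (hu : u < n) (hv : v < n) (hw : w < n) : Between lt u v w ↔ Between lt' u v w := by
  simp only [Between, h u w hu hw, h w v hw hv, h v w hv hw, h w u hw hu]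

theorem IsFlatFoldable.exists_isStacking {n : ℕ} {c : ℕ → ℝ} {μ : ℕ → MV} (hn : 1 ≤ n)
    (hF : IsFlatFoldable n c μ) {ε : ℝ} (hε : ε = 1 ∨ ε = -1) :
    ∃ r : ℕ → ℕ, IsStacking n (foldLo ε c) (foldHi ε c) (fun i => ε * foldCrease c (i + 1)) r ∧
      (∀ J, r J < n) ∧ ∀ i, i + 1 < n →
        (r i < r (i + 1) ↔ (μ (i + 1) = MV.V ∧ Even i) ∨ (μ (i + 1) = MV.M ∧ Odd i)) := by
  classical
  obtain ⟨lt, irr, trans, tot, dom, hmv, hlay, hjoint⟩ := hF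
  let r : ℕ → ℕ := fun J => ((Finset.range n).filter (fun u => lt u J)).card
  have mono : ∀ u v, lt u v → r u < r v := by
    intro u v huv
    apply Finset.card_lt_card
    refine Finset.ssubset_iff_subset_ne.mpr ⟨fun w hw => ?_, fun h => ?_⟩
    · simp only [Finset.mem_filter] at hw ⊢
      exact ⟨hw.1, trans _ _ _ hw.2 huv⟩
    · have : u ∈ (Finset.range n).filter (fun w => lt w v) := by
        simpa [huv] using (dom _ _ huv).1
      rw [← h] at this
      exact irr u (dom _ _ huv).1 (Finset.mem_filter.mp this).2
  have hlt : ∀ u v, u < n → v < n → (lt u v ↔ r u < r v) := by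
    intro u v hu hv
    refine ⟨mono u v, fun h => ?_⟩
    rcases eq_or_ne u v with rfl | huv
    · exact absurd h (lt_irrefl _)
    · exact (tot u v hu hv huv).resolve_right fun h' => absurd (mono _ _ h') h.asymm
  refine ⟨r, ⟨?_, ?_, ?_⟩, ?_, ?_⟩
  · intro u v hu hv h
    by_contra huv
    rcases tot u v hu hv huv with h' | h'
    · exact absurd (mono _ _ h') (by omega)
    · exact absurd (mono _ _ h') (by omega)
  · intro i hi J hJ h h'
    rw [← between_congr hlt (by omega) hi hJ]
    exact hlay (i + 1) (by omega) (by omega) J hJ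
      ((mem_Ioo_min_max_iff hε _ _ _).mpr ⟨h, h'⟩)
  · intro i k hi hk hik h
    rw [← between_congr hlt (by omega) hi hk, ← between_congr hlt (by omega) hi (by omega)]
    refine hjoint (i + 1) (k + 1) (by omega) (by omega) (by omega) (by omega) (by omega) ?_
    exact mul_left_cancel₀ (by rcases hε with rfl | rfl <;> norm_num) h
  · intro J
    by_cases hJ : J < n
    · refine (Finset.card_lt_card ?_).trans_eq (Finset.card_range n)
      exact Finset.filter_ssubset.mpr ⟨J, Finset.mem_range.mpr hJ, irr J hJ⟩
    · have : r J = 0 := by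
        refine Finset.card_eq_zero.mpr (Finset.filter_eq_empty_iff.mpr fun u _ h => ?_)
        exact hJ (dom _ _ h).2
      omega
  · intro i hi
    rw [← hlt i (i + 1) (by omega) hi]
    exact hmv (i + 1) (by omega) (by omega)

theorem IsStacking.isFlatFoldable {n : ℕ} {c : ℕ → ℝ} {μ : ℕ → MV} {ε : ℝ} (hε : ε = 1 ∨ ε = -1)
    {r : ℕ → ℕ}
    (hr : IsStacking n (foldLo ε c) (foldHi ε c) (fun i => ε * foldCrease c (i + 1)) r)
    (hμ : ∀ i, i + 1 < n →
      (r i < r (i + 1) ↔ (μ (i + 1) = MV.V ∧ Even i) ∨ (μ (i + 1) = MV.M ∧ Odd i))) :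
    IsFlatFoldable n c μ := by
  have hlt : ∀ u v, u < n → v < n → ((u < n ∧ v < n ∧ r u < r v) ↔ r u < r v) := by
    intro u v hu hv
    simp [hu, hv]
  refine ⟨fun u v => u < n ∧ v < n ∧ r u < r v, ?_, ?_, ?_, ?_, ?_, ?_, ?_⟩
  · rintro u hu ⟨-, -, h⟩
    exact lt_irrefl _ h
  · rintro u v w ⟨hu, -, h⟩ ⟨-, hw, h'⟩
    exact ⟨hu, hw, h.trans h'⟩
  · intro u v hu hv huv
    have := mt (hr.inj u v hu hv) huv
    omega
  · rintro u v ⟨hu, hv, -⟩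
    exact ⟨hu, hv⟩
  · intro i h1 hi
    obtain ⟨i, rfl⟩ := Nat.exists_eq_add_of_le' h1
    rw [Nat.add_sub_cancel]
    exact (hlt i (i + 1) (by omega) (by omega)).trans (hμ i (by omega))
  · intro i h1 hi J hJ h
    obtain ⟨i, rfl⟩ := Nat.exists_eq_add_of_le' h1
    rw [Nat.add_sub_cancel, between_congr hlt (by omega) (by omega) hJ]
    have h := (mem_Ioo_min_max_iff hε _ _ _).mp h
    exact hr.layer i (by omega) J hJ h.1 h.2
  · intro i k h1 hi h1' hk hik h
    obtain ⟨i, rfl⟩ := Nat.exists_eq_add_of_le' h1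
    obtain ⟨k, rfl⟩ := Nat.exists_eq_add_of_le' h1'
    rw [Nat.add_sub_cancel, Nat.add_sub_cancel, between_congr hlt (by omega) (by omega) (by omega),
      between_congr hlt (by omega) (by omega) (by omega)]
    exact hr.joint i k (by omega) (by omega) (by omega) (by simp only [h])

theorem IsStacking.of_reverse {n : ℕ} {lo hi x : ℕ → ℝ} {r s : ℕ → ℕ}
    (hr : IsStacking n lo hi x r) (hs : ∀ u v, s u < s v ↔ r v < r u) :
    IsStacking n lo hi x s := by
  have hb : ∀ u v w, Between (fun u v => s u < s v) u v w ↔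
      Between (fun u v => r u < r v) u v w := by
    intro u v w
    simp only [Between, hs]
    tauto
  refine ⟨fun u v hu hv h => hr.inj u v hu hv ?_, ?_, ?_⟩
  · have := hs u v
    have := hs v u
    omega
  · simpa only [hb] using hr.layer
  · simpa only [hb] using hr.joint

/-- The layers of a monotone zigzag can be restacked in the opposite order. -/
theorem IsStacking.exists_switched {n a : ℕ} {lo hi x : ℕ → ℝ} {r : ℕ → ℕ}
    (hr : IsStacking n lo hi x r) (hrn : ∀ J, r J < n) (ha : a + 2 < n)
    (hlh : ∀ J, J < n → lo J < hi J)
    (hside : ∀ i, i + 1 < n → (Even (i + a) ∧ hi i = x i ∧ hi (i + 1) = x i) ∨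
      (¬ Even (i + a) ∧ lo i = x i ∧ lo (i + 1) = x i))
    (hA : lo a ≤ x (a + 1)) (hE : x a ≤ hi (a + 2))
    (hmono : r a < r (a + 1) ↔ r (a + 1) < r (a + 2)) :
    ∃ s : ℕ → ℕ, IsStacking n lo hi x s ∧
      (s a < s (a + 1) ↔ ¬ r a < r (a + 1)) ∧
      (s (a + 1) < s (a + 2) ↔ ¬ r a < r (a + 1)) ∧
      ∀ i, i + 1 < n → i ≠ a → i ≠ a + 1 → (s i < s (i + 1) ↔ r i < r (i + 1)) := by
  by_cases h1 : r a < r (a + 1)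
  · obtain ⟨s, hs, hsn, e1, e2, h⟩ :=
      hr.exists_zigzag_reversed hrn ha hlh hside hA hE h1 (hmono.mp h1)
    exact ⟨s, hs, by omega, by omega, h⟩
  · have i0 := hr.inj a (a + 1) (by omega) (by omega)
    have i1 := hr.inj (a + 1) (a + 2) (by omega) (by omega)
    have rev : ∀ u v, n - 1 - r u < n - 1 - r v ↔ r v < r u := by
      intro u v
      have := hrn u
      have := hrn v
      omega
    obtain ⟨s, hs, hsn, e1, e2, h⟩ := (hr.of_reverse rev).exists_zigzag_reversed
      (fun J => by omega) ha hlh hside hA hE ((rev _ _).mpr (by omega)) ((rev _ _).mpr (by omega))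
    have rev' : ∀ u v, n * 9 - s u < n * 9 - s v ↔ s v < s u := by
      intro u v
      have := hsn u
      have := hsn v
      omega
    refine ⟨fun J => n * 9 - s J, hs.of_reverse rev', ?_, ?_, fun i hi hia hia1 => ?_⟩
    · rw [rev']
      omega
    · rw [rev']
      omega
    · have h := h i hi hia hia1
      have := hs.inj i (i + 1) (by omega) hi
      have := hr.inj i (i + 1) (by omega) hi
      rw [rev] at h
      rw [rev']
      omega

/-- Switching the (opposite) MV values of an adjacent pair `(c j, c (j+1))` inside a
crimpable sequence of a flat-foldable MV pattern yields a flat-foldable assignment. -/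
theorem switch_crimp_pair_foldable (n : ℕ) (c : ℕ → ℝ) (μ : ℕ → MV)
    (hC : IsCreasePattern n c) (hF : IsFlatFoldable n c μ)
    (i k : ℕ) (d : ℝ) (hα : IsCrimpable n c i k d)
    (j : ℕ) (hj1 : i ≤ j) (hj2 : j + 1 ≤ i + k) (hμ : μ j ≠ μ (j + 1)) :
    IsFlatFoldable n c
      (Function.update (Function.update μ j (μ (j + 1))) (j + 1) (μ j)) := by
  obtain ⟨hi1, -, hik, hgap, hleft, hright⟩ := hα
  obtain ⟨a, rfl⟩ := Nat.exists_eq_add_of_le' (hi1.trans hj1)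
  have hn : a + 2 < n := by omega
  have hε : (-1 : ℝ) ^ a = 1 ∨ (-1 : ℝ) ^ a = -1 := neg_one_pow_eq_or ℝ a
  have hdA : d ≤ c (a + 1) - c a := by
    rcases hj1.eq_or_lt with rfl | h
    · exact hleft.le
    · exact (hgap a (by omega) (by omega)).ge
  have hdB : c (a + 1 + 1) - c (a + 1) = d := hgap (a + 1) hj1 (by omega)
  have hdE : d ≤ c (a + 2 + 1) - c (a + 2) := by
    rcases hj2.eq_or_lt with h | h
    · rw [← h] at hright
      exact hright.le
    · exact (hgap (a + 2) (by omega) (by omega)).ge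
  obtain ⟨r, hr, hrn, hrμ⟩ := hF.exists_isStacking hC.1 hε
  have e0 := hrμ a (by omega)
  have e1 := hrμ (a + 1) (by omega)
  have hp0 : Odd a ↔ ¬ Even a := Nat.not_even_iff_odd.symm
  have hp1 : Odd (a + 1) ↔ Even a := by rw [← Nat.not_even_iff_odd, Nat.even_add_one, not_not]
  have hmono : r a < r (a + 1) ↔ r (a + 1) < r (a + 2) := by
    rw [e0, e1, hp0, hp1, Nat.even_add_one]
    revert hμ
    cases μ (a + 1) <;> cases μ (a + 1 + 1) <;> simp
  have side0 := foldLo_foldHi_of_even hC (a := a) (J := a) (by omega) ⟨a, rfl⟩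
  have side1 := foldLo_foldHi_of_odd hC (a := a) (J := a + 1) (by omega) (by grind)
  have side2 := foldLo_foldHi_of_even hC (a := a) (J := a + 2) (by omega) (by grind)
  obtain ⟨s, hs, s0, s1, hsr⟩ := hr.exists_switched (a := a) hrn hn
    (by
      intro J hJ
      have hc := hC.2 J (J + 1) (by omega) hJ
      by_cases h : Even (J + a)
      · obtain ⟨h1, h2, h3⟩ := foldLo_foldHi_of_even hC hJ h
        linarith
      · obtain ⟨h1, h2, h3⟩ := foldLo_foldHi_of_odd hC hJ h
        linarith)
    (by
      intro i hi
      by_cases h : Even (i + a)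
      · exact Or.inl ⟨h, (foldLo_foldHi_of_even hC (by omega) h).2.1,
          (foldLo_foldHi_of_odd hC hi (by grind)).2.1⟩
      · exact Or.inr ⟨h, (foldLo_foldHi_of_odd hC (by omega) h).1,
          (foldLo_foldHi_of_even hC hi (by grind)).1⟩)
    (by
      have := side0.2.2
      have := side1.2.2
      rw [side0.1]
      linarith)
    (by
      have := side1.2.2
      have := side2.2.2
      rw [side2.2.1]
      linarith)
    hmono
  refine hs.isFlatFoldable hε fun i hi => ?_
  by_cases hia : i = a
  · subst hia
    rw [s0, hmono, e1, Function.update_of_ne (by omega), Function.update_self, hp0, hp1,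
      Nat.even_add_one]
    cases μ (i + 1 + 1) <;> simp
  by_cases hia1 : i = a + 1
  · subst hia1
    rw [s1, e0, Function.update_self, hp0, hp1, Nat.even_add_one]
    cases μ (a + 1) <;> simp
  rw [hsr i hi hia hia1, hrμ i hi, Function.update_of_ne (by omega),
    Function.update_of_ne (by omega)]
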